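/- Let k be a field of characteristic zero and G a finite small subgroup of GL_d(k) acting on the polynomial ring S = k[x_1,…,x_d], with invariant subring R = S^G. If i < 0, then every R-linear endomorphism f of S that is homogeneous of degree i (i.e., f(S_n) ⊆ S_{n+i} for all n) is zero. -/

import Mathlib

open MvPolynomial Matrix

noncomputable section

variable (k : Type) [Field k] (d : ℕ)

/-- The `k`-algebra endomorphism of `S = k[x_1,…,x_d]` induced by a `d × d` matrix `M`,
sending the variable `X i` to the linear form `∑ j, M j i • X j`.  This is the action of
`GL_d(k)` on `S` extending the linear action on the degree-one part `V`. -/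
def matAct (M : Matrix (Fin d) (Fin d) k) :
    MvPolynomial (Fin d) k →ₐ[k] MvPolynomial (Fin d) k :=
  aeval fun i => ∑ j, M j i • X j

/-- The invariant subalgebra `R = S^G` of a subgroup `G ≤ GL_d(k)`. -/
def invR (G : Subgroup (GL (Fin d) k)) : Subalgebra k (MvPolynomial (Fin d) k) where
  carrier := {s | ∀ g ∈ G, matAct k d (g : Matrix (Fin d) (Fin d) k) s = s}
  mul_mem' ha hb := fun g hg => by rw [_root_.map_mul, ha g hg, hb g hg]
  add_mem' ha hb := fun g hg => by rw [_root_.map_add, ha g hg, hb g hg]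
  algebraMap_mem' r := fun g hg => (matAct k d _).commutes r

/-- `G ≤ GL_d(k)` is small if it contains no pseudo-reflection (an element `g` with
`rank (g - 1) ≤ 1`) other than the identity. -/
def IsSmall (G : Subgroup (GL (Fin d) k)) : Prop :=
  ∀ g ∈ G, ((g : Matrix (Fin d) (Fin d) k) - 1).rank ≤ 1 → g = 1

theorem aux_interp {S G : Type*} [CommRing S] [IsDomain S] [Group G] [Fintype G] [DecidableEq G]
    (φ : G →* (S →+* S)) (a : S) (ha : Function.Injective fun g => φ g a)
    (f : S →+ S) (hf : ∀ r, (∀ g, φ g r = r) → ∀ s, f (r * s) = r * f s) :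
    ∃ N : S, N ≠ 0 ∧ ∃ b : G → S, ∀ s, N * f s = ∑ g, b g * φ g s := by
  have hmul : ∀ g h s, φ (g * h) s = φ g (φ h s) := fun g h s => by rw [_root_.map_mul]; rfl
  have hone : ∀ s, φ 1 s = s := fun s => by rw [_root_.map_one]; rfl
  have hinj : ∀ g, Function.Injective (φ g) := fun g x y hxy => by
    have := congrArg (φ g⁻¹) hxy
    simpa [← hmul, hone] using this
  let Q : G → Polynomial S := fun g =>
    ∏ h ∈ Finset.univ.erase g, (Polynomial.X - Polynomial.C (φ h a))
  have hQ : ∀ g0 g, (Q g).map (φ g0) = Q (g0 * g) := by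
    intro g0 g
    simp only [Q, Polynomial.map_prod, Polynomial.map_sub, Polynomial.map_X, Polynomial.map_C,
      ← hmul]
    refine Finset.prod_bij (fun h _ => g0 * h) ?_ ?_ ?_ ?_
    · intro h hh; simpa using hh
    · intro x _ y _ hxy; simpa using hxy
    · intro y hy
      refine ⟨g0⁻¹ * y, ?_, by simp⟩
      simp only [Finset.mem_erase, Finset.mem_univ, and_true, ne_eq] at hy ⊢
      intro h; apply hy; rw [← h]; simp
    · intro _ _; rfl
  let r : ℕ → S → S := fun j s => ∑ g, φ g s * (Q g).coeff j
  have hr : ∀ j s g0, φ g0 (r j s) = r j s := by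
    intro j s g0
    simp only [r]
    rw [map_sum]
    refine Fintype.sum_equiv (Equiv.mulLeft g0) _ _ (fun g => ?_)
    rw [RingHom.map_mul, ← hmul, ← Polynomial.coeff_map, hQ]
    rfl
  let n : ℕ := (Finset.univ.sup fun g => (Q g).natDegree) + 1
  have hn : ∀ g, (Q g).natDegree < n := fun g =>
    Nat.lt_succ_of_le (Finset.le_sup (f := fun g => (Q g).natDegree) (Finset.mem_univ g))
  let D : S := (Q 1).eval a
  have hD : D ≠ 0 := by
    simp only [D, Q, Polynomial.eval_prod, Polynomial.eval_sub, Polynomial.eval_X,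
      Polynomial.eval_C]
    refine Finset.prod_ne_zero_iff.2 fun h hh => ?_
    intro h0
    have : φ 1 a = φ h a := by rw [hone]; exact sub_eq_zero.1 h0
    exact (Finset.mem_erase.1 hh).1 (ha this).symm
  have hQ0 : ∀ g, g ≠ 1 → (Q g).eval a = 0 := by
    intro g hg
    simp only [Q, Polynomial.eval_prod, Polynomial.eval_sub, Polynomial.eval_X,
      Polynomial.eval_C]
    refine Finset.prod_eq_zero (i := 1) (by simpa using hg.symm) ?_
    rw [hone, sub_self]
  have hsum : ∀ s, ∑ j ∈ Finset.range n, r j s * a ^ j = D * s := by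
    intro s
    simp only [r, Finset.sum_mul]
    rw [Finset.sum_comm]
    rw [Finset.sum_eq_single (1 : G)]
    · simp only [D, hone]
      rw [Polynomial.eval_eq_sum_range' (hn 1), Finset.sum_mul]
      exact Finset.sum_congr rfl fun _ _ => by ring
    · intro g _ hg
      have := hQ0 g hg
      rw [Polynomial.eval_eq_sum_range' (hn g)] at this
      simp only [mul_assoc]
      rw [← Finset.mul_sum, this, mul_zero]
    · simp
  let D' : S := ∏ g ∈ Finset.univ.erase (1 : G), φ g D
  let N : S := ∏ g, φ g D
  have hN : N = D' * D := by
    simp only [N, D']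
    rw [← Finset.prod_erase_mul _ _ (Finset.mem_univ (1 : G)), hone]
  have hNinv : ∀ g, φ g N = N := by
    intro g
    simp only [N, map_prod, ← hmul]
    exact Fintype.prod_equiv (Equiv.mulLeft g) _ _ (fun _ => rfl)
  refine ⟨N, ?_, fun g => ∑ j ∈ Finset.range n, (Q g).coeff j * f (D' * a ^ j), ?_⟩
  · refine Finset.prod_ne_zero_iff.2 fun g _ h0 => hD (hinj g ?_)
    rw [h0, map_zero]
  · intro s
    rw [← hf N hNinv, hN, mul_assoc, ← hsum, Finset.mul_sum, map_sum]
    have : ∀ j, f (D' * (r j s * a ^ j)) = r j s * f (D' * a ^ j) := by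
      intro j
      rw [← hf _ (hr j s)]
      congr 1; ring
    simp only [this]
    simp only [r, Finset.sum_mul]
    rw [Finset.sum_comm]
    refine Finset.sum_congr rfl fun _ _ => Finset.sum_congr rfl fun _ _ => by ring

theorem aux_mult {S G : Type*} [CommRing S] [Fintype G] [DecidableEq G]
    (φ : G → (S →+* S)) (a : G → S) (f : S → S) (N : S) (b : G → S)
    (hf : ∀ s, N * f s = ∑ g, b g * φ g s) (T : Finset G) :
    ∃ F : S → S, ∀ s, N * F s = ∑ g', b g' * (∏ g ∈ T, (φ g' (a g) - φ g (a g))) * φ g' s := by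
  induction T using Finset.induction_on with
  | empty => exact ⟨f, fun s => by simpa using hf s⟩
  | insert g T hg ih =>
    obtain ⟨F, hF⟩ := ih
    refine ⟨fun s => F (a g * s) - φ g (a g) * F s, fun s => ?_⟩
    rw [mul_sub, hF, mul_left_comm, hF, Finset.mul_sum, ← Finset.sum_sub_distrib]
    refine Finset.sum_congr rfl fun g' _ => ?_
    rw [Finset.prod_insert hg, _root_.map_mul]
    ring

theorem aux_dvd_prod {S G : Type*} [CommRing S] [Fintype G] [DecidableEq G]
    (φ : G → (S →+* S)) (a : G → S) (f : S → S) (N : S) (b : G → S)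
    (hf : ∀ s, N * f s = ∑ g, b g * φ g s) (h : G) :
    N ∣ b h * ∏ g ∈ Finset.univ.erase h, (φ h (a g) - φ g (a g)) := by
  obtain ⟨F, hF⟩ := aux_mult φ a f N b hf (Finset.univ.erase h)
  refine ⟨F 1, ?_⟩
  rw [hF, Finset.sum_eq_single h]
  · simp
  · intro g _ hg
    rw [Finset.prod_eq_zero (i := g) (by simpa using hg) (sub_self _)]
    simp
  · simp

theorem aux_ufd {S : Type*} [CommRing S] [IsDomain S] [UniqueFactorizationMonoid S]
    (N : S) (hN : N ≠ 0) (b : S) (h : ∀ p : S, Prime p → ∃ w, ¬ p ∣ w ∧ N ∣ b * w) : N ∣ b := by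
  induction N using UniqueFactorizationMonoid.induction_on_prime with
  | h₁ => exact absurd rfl hN
  | h₂ x hx => exact hx.dvd
  | h₃ N' p hN' hp ih =>
    obtain ⟨b', rfl⟩ := ih hN' fun q hq => by
      obtain ⟨w, h1, h2⟩ := h q hq
      exact ⟨w, h1, (Dvd.intro_left p rfl).trans h2⟩
    obtain ⟨w, h1, h2⟩ := h p hp
    rw [mul_comm p, mul_assoc, mul_dvd_mul_iff_left hN'] at h2
    rw [mul_comm p]
    exact mul_dvd_mul_left _ ((hp.dvd_or_dvd h2).resolve_right h1)

theorem matAct_X (k : Type) [Field k] (d : ℕ) (M : Matrix (Fin d) (Fin d) k) (i : Fin d) :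
    matAct k d M (X i) = ∑ j, M j i • X j := by
  simp [matAct]

theorem matAct_X_coeff (k : Type) [Field k] (d : ℕ) (M : Matrix (Fin d) (Fin d) k)
    (i j : Fin d) : coeff (Finsupp.single j 1) (matAct k d M (X i)) = M j i := by
  classical
  rw [matAct_X, coeff_sum]
  simp only [coeff_smul, coeff_X, smul_eq_mul]
  rw [Finset.sum_eq_single j]
  · simp
  · intro l _ hl
    rw [if_neg, mul_zero]
    intro h
    exact hl (Finsupp.single_left_injective one_ne_zero h)
  · simp

theorem matAct_hom (k : Type) [Field k] (d : ℕ) (M : Matrix (Fin d) (Fin d) k)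
    (n : ℕ) (s : MvPolynomial (Fin d) k) (hs : s.IsHomogeneous n) :
    (matAct k d M s).IsHomogeneous n := by
  have := hs.aeval (fun i => ∑ j, M j i • (X j : MvPolynomial (Fin d) k)) (n := 1) (fun i => by
    refine IsHomogeneous.sum _ _ _ fun j _ => ?_
    rw [smul_eq_C_mul]
    simpa using (isHomogeneous_C (Fin d) (M j i)).mul (isHomogeneous_X k j))
  simpa [matAct] using this

theorem matAct_mul (k : Type) [Field k] (d : ℕ) (M N : Matrix (Fin d) (Fin d) k) :
    matAct k d (M * N) = (matAct k d M).comp (matAct k d N) := by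
  apply MvPolynomial.algHom_ext
  intro i
  rw [AlgHom.comp_apply, matAct_X, matAct_X, map_sum]
  simp only [map_smul, matAct_X, Matrix.mul_apply, Finset.sum_smul, Finset.smul_sum, smul_smul]
  rw [Finset.sum_comm]
  simp only [mul_comm]

theorem matAct_one (k : Type) [Field k] (d : ℕ) : matAct k d 1 = AlgHom.id k _ := by
  apply MvPolynomial.algHom_ext
  intro i
  rw [matAct_X]
  simp [Matrix.one_apply, ite_smul]

theorem matAct_sub_X (k : Type) [Field k] (d : ℕ) (M N : Matrix (Fin d) (Fin d) k) (i : Fin d) :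
    matAct k d M (X i) - matAct k d N (X i) = matAct k d (M - N) (X i) := by
  simp [matAct_X, sub_smul]

theorem aux_deg {k : Type} [Field k] {d : ℕ} (p q : MvPolynomial (Fin d) k)
    (hp : 1 ≤ p.totalDegree) (hpq : p * q ≠ 0) (h1 : (p * q).IsHomogeneous 1) :
    ∃ c : k, c ≠ 0 ∧ q = C c := by
  have hp0 : p ≠ 0 := left_ne_zero_of_mul hpq
  have hq0 : q ≠ 0 := right_ne_zero_of_mul hpq
  have h2 := h1.totalDegree hpq
  rw [totalDegree_mul_of_isDomain hp0 hq0] at h2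
  have h3 : q.totalDegree = 0 := by omega
  rw [totalDegree_eq_zero_iff_eq_C] at h3
  refine ⟨_, ?_, h3⟩
  intro h0
  rw [h0, map_zero] at h3
  exact hq0 h3

theorem aux_rank (k : Type) [Field k] (d : ℕ) (M : Matrix (Fin d) (Fin d) k)
    (p : MvPolynomial (Fin d) k) (hp : Prime p) (h : ∀ j, p ∣ matAct k d M (X j)) :
    M.rank ≤ 1 := by
  by_cases hM : ∀ j, matAct k d M (X j) = 0
  · have : M = 0 := by
      ext a b
      rw [← matAct_X_coeff k d M b a, hM]; simp
    rw [this, Matrix.rank_zero]; exact zero_le_one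
  push Not at hM
  obtain ⟨j0, hj0⟩ := hM
  have hp1 : 1 ≤ p.totalDegree := by
    by_contra hlt
    have h0 : p.totalDegree = 0 := by omega
    rw [totalDegree_eq_zero_iff_eq_C] at h0
    apply hp.not_isUnit
    rw [h0]
    refine IsUnit.map C (IsUnit.mk0 _ ?_)
    intro h1
    rw [h1, map_zero] at h0
    exact hp.ne_zero h0
  have hall : ∀ j, ∃ c : k, matAct k d M (X j) = C c * p := by
    intro j
    obtain ⟨q, hq⟩ := h j
    by_cases h0 : matAct k d M (X j) = 0
    · exact ⟨0, by simp [h0]⟩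
    obtain ⟨c, _, hc⟩ := aux_deg p q hp1 (hq ▸ h0)
      (hq ▸ matAct_hom k d M 1 _ (isHomogeneous_X k j))
    exact ⟨c, by rw [hq, hc, mul_comm]⟩
  choose c hc using hall
  have : M = Matrix.vecMulVec (fun a => coeff (Finsupp.single a 1) p) c := by
    ext a b
    rw [← matAct_X_coeff k d M b a, hc, coeff_C_mul, Matrix.vecMulVec_apply, mul_comm]
  rw [this]
  exact Matrix.rank_vecMulVec_le _ _

def actHom (k : Type) [Field k] (d : ℕ) (G : Subgroup (GL (Fin d) k)) :
    G →* (MvPolynomial (Fin d) k →+* MvPolynomial (Fin d) k) where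
  toFun g := (matAct k d ((g : GL (Fin d) k) : Matrix (Fin d) (Fin d) k)).toRingHom
  map_one' := by
    apply RingHom.ext
    intro x
    simp [matAct_one]
  map_mul' g h := by
    apply RingHom.ext
    intro x
    simp [matAct_mul]

theorem actHom_apply (k : Type) [Field k] (d : ℕ) (G : Subgroup (GL (Fin d) k)) (g : G)
    (s : MvPolynomial (Fin d) k) :
    actHom k d G g s = matAct k d ((g : GL (Fin d) k) : Matrix (Fin d) (Fin d) k) s := rfl

theorem aux_sep (k : Type) [Field k] [CharZero k] (d : ℕ) (G : Subgroup (GL (Fin d) k))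
    [Finite G] : ∃ a, Function.Injective fun g => actHom k d G g a := by
  classical
  have : Fintype G := Fintype.ofFinite G
  let P : G × G → Submodule k (MvPolynomial (Fin d) k) := fun x =>
    LinearMap.ker ((matAct k d ((x.1 : GL (Fin d) k) : Matrix (Fin d) (Fin d) k)).toLinearMap -
      (matAct k d ((x.2 : GL (Fin d) k) : Matrix (Fin d) (Fin d) k)).toLinearMap)
  let T : Finset (Submodule k (MvPolynomial (Fin d) k)) :=
    (Finset.univ.filter fun x : G × G => x.1 ≠ x.2).image P
  have hT : ⊤ ∉ T := by
    intro h
    simp only [T, Finset.mem_image, Finset.mem_filter, Finset.mem_univ, true_and] at h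
    obtain ⟨⟨g, h⟩, hne, htop⟩ := h
    apply hne
    apply Subtype.ext
    apply Units.ext
    ext a b
    refine (matAct_X_coeff k d _ b a).symm.trans (Eq.trans ?_ (matAct_X_coeff k d _ b a))
    have : (X b : MvPolynomial (Fin d) k) ∈ P (g, h) := by rw [htop]; trivial
    simp only [P, LinearMap.mem_ker, LinearMap.sub_apply, sub_eq_zero] at this
    exact congrArg _ this
  have := Subspace.biUnion_ne_univ_of_top_notMem hT
  obtain ⟨a, ha⟩ := (Set.ne_univ_iff_exists_notMem _).1 this
  refine ⟨a, fun g h hgh => ?_⟩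
  by_contra hne
  apply ha
  simp only [Set.mem_iUnion]
  refine ⟨P (g, h), Finset.mem_image.2 ⟨(g, h), by simpa using hne, rfl⟩, ?_⟩
  simp only [P, SetLike.mem_coe, LinearMap.mem_ker, LinearMap.sub_apply, sub_eq_zero]
  exact hgh

theorem aux_small (k : Type) [Field k] (d : ℕ) (G : Subgroup (GL (Fin d) k))
    (hG : IsSmall k d G) (p : MvPolynomial (Fin d) k) (hp : Prime p) (g h : G) (hgh : g ≠ h) :
    ∃ j, ¬ p ∣ actHom k d G h (X j) - actHom k d G g (X j) := by
  by_contra hcon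
  push Not at hcon
  simp only [actHom_apply, matAct_sub_X] at hcon
  have hr := aux_rank k d _ p hp hcon
  apply hgh
  have h1 := hG (g⁻¹ * h : G) (g⁻¹ * h : G).2 (by
    have : (((g⁻¹ * h : G) : GL (Fin d) k) : Matrix (Fin d) (Fin d) k) - 1 =
        (((g⁻¹ : G) : GL (Fin d) k) : Matrix (Fin d) (Fin d) k) *
          (((h : GL (Fin d) k) : Matrix (Fin d) (Fin d) k) - (g : GL (Fin d) k)) := by
      rw [mul_sub]
      congr 1
      rw [← Units.val_mul]; simp
    rw [this]
    exact (Matrix.rank_mul_le_right _ _).trans hr)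
  have h2 : g⁻¹ * h = 1 := Subtype.ext h1
  exact inv_mul_eq_one.1 h2

/-- if `G` is a finite small subgroup of `GL_d(k)` (char `k` = 0) with
invariant ring `R = S^G`, then every `R`-linear endomorphism of `S` which is homogeneous
of negative degree `i` is zero. -/
theorem stmt_1 (k : Type) [Field k] [CharZero k] (d : ℕ)
    (G : Subgroup (GL (Fin d) k)) [Finite G] (hG : IsSmall k d G)
    (i : ℤ) (hi : i < 0)
    (f : MvPolynomial (Fin d) k →ₗ[↥(invR k d G)] MvPolynomial (Fin d) k)
    (hgr : ∀ (n m : ℕ), (m : ℤ) = (n : ℤ) + i →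
      ∀ s ∈ homogeneousSubmodule (Fin d) k n, f s ∈ homogeneousSubmodule (Fin d) k m)
    (hgr0 : ∀ n : ℕ, (n : ℤ) + i < 0 →
      ∀ s ∈ homogeneousSubmodule (Fin d) k n, f s = 0) :
    f = 0 := by
  classical
  have : Fintype G := Fintype.ofFinite G
  obtain ⟨a, ha⟩ := aux_sep k d G
  obtain ⟨N, hN, b, hb⟩ := aux_interp (actHom k d G) a ha f.toAddMonoidHom (by
    intro r hr s
    have hmem : r ∈ invR k d G := fun g hg => hr ⟨g, hg⟩
    exact f.map_smul (⟨r, hmem⟩ : invR k d G) s)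
  have hdvd : ∀ h, N ∣ b h := by
    intro h
    refine aux_ufd N hN (b h) fun p hp => ?_
    have : ∀ g : G, ∃ j, g ≠ h → ¬ p ∣ actHom k d G h j - actHom k d G g j := by
      intro g
      by_cases hg : g = h
      · exact ⟨0, fun h' => absurd hg h'⟩
      · obtain ⟨j, hj⟩ := aux_small k d G hG p hp g h hg
        exact ⟨X j, fun _ => hj⟩
    choose x hx using this
    refine ⟨_, ?_, aux_dvd_prod (actHom k d G) x f N b hb h⟩
    rw [hp.dvd_finsetProd_iff]
    rintro ⟨g, hg, hdiv⟩
    exact hx g (Finset.mem_erase.1 hg).1 hdiv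
  choose c hc using hdvd
  have hfc : ∀ s, f s = ∑ g, c g * actHom k d G g s := by
    intro s
    apply mul_left_cancel₀ hN
    refine (hb s).trans ?_
    rw [Finset.mul_sum]
    exact Finset.sum_congr rfl fun g _ => by rw [hc g, mul_assoc]
  have hzero : ∀ n s, s ∈ homogeneousSubmodule (Fin d) k n → f s = 0 := by
    intro n s hs
    by_cases hni : (n : ℤ) + i < 0
    · exact hgr0 n hni s hs
    obtain ⟨m, hm⟩ := Int.eq_ofNat_of_zero_le (not_lt.1 hni)
    have h1 := hgr n m hm.symm s hs
    rw [mem_homogeneousSubmodule] at h1 hs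
    rw [← homogeneousComponent_of_mem h1 (m := m) |>.trans (if_pos rfl), hfc, map_sum]
    refine Finset.sum_eq_zero fun g _ => ?_
    have h2 : (actHom k d G g s).IsHomogeneous n := matAct_hom k d _ n s hs
    ext e
    rw [coeff_homogeneousComponent, coeff_zero]
    split_ifs with he
    · rw [coeff_mul]
      refine Finset.sum_eq_zero fun x hx => ?_
      rw [h2.coeff_eq_zero, mul_zero]
      rw [Finset.HasAntidiagonal.mem_antidiagonal] at hx
      have : x.1.degree + x.2.degree = m := by rw [← he, ← hx, map_add]
      omega
    · rfl
  ext1 s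
  rw [← sum_homogeneousComponent s, map_sum, LinearMap.zero_apply]
  exact Finset.sum_eq_zero fun n _ => hzero n _ (homogeneousComponent_isHomogeneous n s)
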